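/- Let K be a symmetric positive definite d×d real matrix with d ≥ 2. Then the maximum over all pairs (C, D) with D symmetric positive semidefinite, Tr(D) ≤ d, J antisymmetric, C = (D+J)K⁻¹, of the spectral gap ρ(C) := min{Re(λ) : λ ∈ σ(C)} equals λ_max(K⁻¹) = 1/λ_min(K); i.e., the maximum is attained by some admissible pair. -/

import Mathlib

open Matrix

/-- A right-hand Lyapunov identity with a positive definite weight pins the real part of every
complex eigenvalue. -/
theorem re_eq_of_mem_spectrum_of_lyapunov {n : Type*} [Fintype n] [DecidableEq n]
    {C Q : Matrix n n ℝ} (hQ : Q.PosDef) {c : ℝ} (h : C * Q + (C * Q)ᵀ = (2 * c) • Q)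
    {z : ℂ} (hz : z ∈ spectrum ℂ (C.map Complex.ofReal)) : z.re = c := by
  have hdet : (algebraMap ℂ (Matrix n n ℂ) z - C.map Complex.ofReal).det = 0 := by
    by_contra hne
    exact hz ((Matrix.isUnit_iff_isUnit_det _).2 (isUnit_iff_ne_zero.2 hne))
  obtain ⟨x, hx0, hx⟩ := Matrix.exists_vecMul_eq_zero_iff.2 hdet
  have hxC : x ᵥ* C.map Complex.ofReal = z • x := by
    rw [Matrix.vecMul_sub, sub_eq_zero, Algebra.algebraMap_eq_smul_one, Matrix.vecMul_smul,
      Matrix.vecMul_one] at hx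
    exact hx.symm
  set a : n → ℝ := fun i => (x i).re with ha
  set b : n → ℝ := fun i => (x i).im with hb
  have hre : a ᵥ* C = z.re • a - z.im • b := by
    ext j
    have := congrArg Complex.re (congrFun hxC j)
    simpa [Matrix.vecMul, dotProduct, ha, hb] using this
  have him : b ᵥ* C = z.re • b + z.im • a := by
    ext j
    have := congrArg Complex.im (congrFun hxC j)
    simpa [Matrix.vecMul, dotProduct, ha, hb] using this
  have quad (y : n → ℝ) : y ᵥ* (C * Q) ⬝ᵥ y = c * (y ᵥ* Q ⬝ᵥ y) := by
    have h1 := congrArg (fun N => y ᵥ* N ⬝ᵥ y) h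
    simp only [Matrix.vecMul_add, add_dotProduct, Matrix.vecMul_smul, smul_dotProduct,
      Matrix.vecMul_transpose, smul_eq_mul] at h1
    rw [dotProduct_comm ((C * Q) *ᵥ y), dotProduct_mulVec] at h1
    linarith
  have hsymm : b ᵥ* Q ⬝ᵥ a = a ᵥ* Q ⬝ᵥ b := by
    have hT : Qᵀ = Q := by simpa using hQ.isHermitian.eq
    rw [← dotProduct_mulVec, ← Matrix.vecMul_transpose, hT, dotProduct_comm]
  have hsum : (z.re - c) * (a ᵥ* Q ⬝ᵥ a + b ᵥ* Q ⬝ᵥ b) = 0 := by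
    have h1 := quad a
    have h2 := quad b
    rw [← Matrix.vecMul_vecMul, hre, Matrix.sub_vecMul, Matrix.smul_vecMul, Matrix.smul_vecMul,
      sub_dotProduct, smul_dotProduct, smul_dotProduct, smul_eq_mul, smul_eq_mul] at h1
    rw [← Matrix.vecMul_vecMul, him, Matrix.add_vecMul, Matrix.smul_vecMul, Matrix.smul_vecMul,
      add_dotProduct, smul_dotProduct, smul_dotProduct, smul_eq_mul, smul_eq_mul] at h2
    rw [hsymm] at h1
    linarith
  have nonneg (y : n → ℝ) : 0 ≤ y ᵥ* Q ⬝ᵥ y := by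
    rw [← dotProduct_mulVec]
    simpa using hQ.posSemidef.dotProduct_mulVec_nonneg y
  have pos {y : n → ℝ} (hy : y ≠ 0) : 0 < y ᵥ* Q ⬝ᵥ y := by
    rw [← dotProduct_mulVec]
    simpa using hQ.dotProduct_mulVec_pos hy
  have hne : a ᵥ* Q ⬝ᵥ a + b ᵥ* Q ⬝ᵥ b ≠ 0 := by
    by_cases ha0 : a = 0
    · have hb0 : b ≠ 0 := by
        rintro hb0
        exact hx0 (funext fun i => Complex.ext (congrFun ha0 i) (congrFun hb0 i))
      linarith [nonneg a, pos hb0]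
    · linarith [nonneg b, pos ha0]
  linarith [(mul_eq_zero.1 hsum).resolve_right hne]

/-- The smallest real part in the spectrum is at most the averaged trace. -/
theorem card_mul_sInf_re_spectrum_le_re_trace {n : Type*} [Fintype n] [DecidableEq n]
    (A : Matrix n n ℂ) :
    Fintype.card n * sInf (Complex.re '' spectrum ℂ A) ≤ A.trace.re := by
  have hbdd : BddBelow (Complex.re '' spectrum ℂ A) :=
    (A.finite_spectrum.image _).bddBelow
  have hcard : A.charpoly.roots.card = Fintype.card n := by
    rw [IsAlgClosed.card_roots_eq_natDegree, charpoly_natDegree_eq_dim]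
  have hre : A.trace.re = (A.charpoly.roots.map Complex.re).sum := by
    rw [trace_eq_sum_roots_charpoly]
    exact map_multiset_sum Complex.reAddGroupHom _
  have key := Multiset.card_nsmul_le_sum (s := A.charpoly.roots.map Complex.re)
    (a := sInf (Complex.re '' spectrum ℂ A)) (by
      intro r hr
      obtain ⟨z, hz, rfl⟩ := Multiset.mem_map.1 hr
      exact csInf_le hbdd ⟨z, mem_spectrum_of_isRoot_charpoly (Polynomial.isRoot_of_mem_roots hz),
        rfl⟩)
  rw [hre]
  simpa [hcard] using key

theorem trace_mul_eq_zero_of_transpose_eq_neg {n : Type*} [Fintype n] {J S : Matrix n n ℝ}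
    (hJ : Jᵀ = -J) (hS : Sᵀ = S) : (J * S).trace = 0 := by
  have h : (J * S).trace = -(J * S).trace := by
    conv_lhs => rw [← trace_transpose, transpose_mul, hJ, hS, mul_neg, trace_neg, trace_mul_comm]
  linarith

theorem exists_orthogonal_row_const {n : Type*} [Fintype n] [DecidableEq n] (i₀ : n) :
    ∃ W : Matrix n n ℝ, W * Wᵀ = 1 ∧ ∀ j, W i₀ j = (√(Fintype.card n))⁻¹ := by
  have hn : (0 : ℝ) < Fintype.card n := by exact_mod_cast Fintype.card_pos_iff.2 ⟨i₀⟩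
  let u : EuclideanSpace ℝ n := WithLp.toLp 2 fun _ => (√(Fintype.card n))⁻¹
  have hu : ‖u‖ = 1 := by
    rw [EuclideanSpace.norm_eq]
    simp [u, hn.ne']
  have horth : Orthonormal ℝ (({i₀} : Set n).domRestrict fun _ => u) := by
    constructor
    · intro _; exact hu
    · intro i j hij; exact (hij (Subsingleton.elim _ _)).elim
  obtain ⟨b, hb⟩ := horth.exists_orthonormalBasis_extension_of_card_eq (by simp)
  refine ⟨Matrix.of fun i j => b i j, ?_, fun j => ?_⟩
  · ext i j
    have := b.inner_eq_ite i j
    simpa [Matrix.mul_apply, PiLp.inner_apply, Matrix.one_apply, mul_comm] using this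
  · simp [hb i₀ rfl, u]

/-- Real form of the spectral theorem for a symmetric matrix. -/
theorem Matrix.IsHermitian.exists_orthogonal_diagonalization {n : Type*} [Fintype n]
    [DecidableEq n] {K : Matrix n n ℝ} (hK : K.IsHermitian) :
    ∃ V : Matrix n n ℝ, V * Vᵀ = 1 ∧ K = V * diagonal hK.eigenvalues * Vᵀ := by
  refine ⟨hK.eigenvectorUnitary, ?_, ?_⟩
  · simpa [star_eq_conjTranspose] using Unitary.coe_mul_star_self hK.eigenvectorUnitary
  · have h := hK.spectral_theorem
    rw [Unitary.conjStarAlgAut_apply] at h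
    simpa [star_eq_conjTranspose, Function.comp_def] using h

/-- Pairing a positive semidefinite matrix with `K⁻¹` is controlled by a lower bound on the
eigenvalues of `K`. -/
theorem trace_mul_inv_le {n : Type*} [Fintype n] [DecidableEq n] {K D : Matrix n n ℝ}
    (hK : K.PosDef) (hD : D.PosSemidef) {m : ℝ} (hm : 0 < m)
    (hle : ∀ i, m ≤ hK.isHermitian.eigenvalues i) : (D * K⁻¹).trace ≤ m⁻¹ * D.trace := by
  obtain ⟨V, hV, hKV⟩ := hK.isHermitian.exists_orthogonal_diagonalization
  set l := hK.isHermitian.eigenvalues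
  have hV' : Vᵀ * V = 1 := mul_eq_one_comm.1 hV
  have hl (i : n) : l i ≠ 0 := (hm.trans_le (hle i)).ne'
  have hinv : K⁻¹ = V * diagonal (fun i => (l i)⁻¹) * Vᵀ := by
    apply Matrix.inv_eq_right_inv
    calc K * (V * diagonal (fun i => (l i)⁻¹) * Vᵀ)
        = V * diagonal l * (Vᵀ * V) * diagonal (fun i => (l i)⁻¹) * Vᵀ := by
          conv_lhs => rw [hKV]
          simp only [Matrix.mul_assoc]
      _ = 1 := by
          rw [hV', Matrix.mul_one, Matrix.mul_assoc V, diagonal_mul_diagonal]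
          simp [hl, hV]
  have hP : (Vᵀ * D * V).PosSemidef := by simpa using hD.conjTranspose_mul_mul_same V
  have h1 : (D * K⁻¹).trace = ∑ i, (Vᵀ * D * V) i i * (l i)⁻¹ := by
    rw [hinv, ← Matrix.mul_assoc, trace_mul_comm, ← Matrix.mul_assoc, ← Matrix.mul_assoc]
    simp [trace, mul_diagonal]
  have h2 : D.trace = ∑ i, (Vᵀ * D * V) i i := by
    change _ = (Vᵀ * D * V).trace
    rw [trace_mul_comm, ← Matrix.mul_assoc, hV, Matrix.one_mul]
  rw [h1, h2, Finset.mul_sum]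
  refine Finset.sum_le_sum fun i _ => ?_
  rw [mul_comm]
  exact mul_le_mul_of_nonneg_right (inv_anti₀ hm (hle i)) hP.diag_nonneg

/-- The all-ones matrix plus a Cauchy-type antisymmetric matrix solves a Lyapunov identity with
diagonal weight. -/
theorem cauchy_lyapunov {n : Type*} [Fintype n] [DecidableEq n] {q : n → ℝ}
    (hq : Function.Injective q) :
    let M : Matrix n n ℝ := of (fun _ _ => 1) + of fun j k => (q j + q k) / (q j - q k)
    M * diagonal q + (M * diagonal q)ᵀ = (2 : ℝ) • diagonal q := by
  ext j k
  simp only [Matrix.add_apply, transpose_apply, mul_diagonal, of_apply, Matrix.smul_apply, smul_eq_mul]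
  by_cases h : j = k
  · subst h
    simp
    ring
  · have h1 : q j - q k ≠ 0 := sub_ne_zero.2 fun h' => h (hq h')
    have h2 : q k - q j ≠ 0 := sub_ne_zero.2 fun h' => h (hq h').symm
    rw [diagonal_apply_ne _ h]
    have h3 : q k - q j = -(q j - q k) := by ring
    rw [h3, div_neg]
    field_simp
    ring

/-- A factorization `K = R Rᵀ` for which `R 𝟙` has prescribed squared norm
`card n` times a chosen eigenvalue of `K`. -/
theorem exists_factorization_sum_sq {n : Type*} [Fintype n] [DecidableEq n] {K : Matrix n n ℝ}
    (hK : K.PosDef) (i₀ : n) :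
    ∃ R : Matrix n n ℝ, R * Rᵀ = K ∧
      (R * of (fun _ _ => (1 : ℝ)) * Rᵀ).trace =
        Fintype.card n * hK.isHermitian.eigenvalues i₀ := by
  obtain ⟨V, hV, hKV⟩ := hK.isHermitian.exists_orthogonal_diagonalization
  have hV' : Vᵀ * V = 1 := mul_eq_one_comm.1 hV
  obtain ⟨W, hW, hrow⟩ := exists_orthogonal_row_const i₀
  have hpos := hK.eigenvalues_pos
  set l := hK.isHermitian.eigenvalues
  have hcard : (0 : ℝ) < Fintype.card n := by exact_mod_cast Fintype.card_pos_iff.2 ⟨i₀⟩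
  have hsqrt : diagonal (fun i => √(l i)) * diagonal (fun i => √(l i)) = diagonal l := by
    rw [diagonal_mul_diagonal]
    congr 1
    ext i
    exact Real.mul_self_sqrt (hpos i).le
  refine ⟨V * diagonal (fun i => √(l i)) * W, ?_, ?_⟩
  · calc V * diagonal (fun i => √(l i)) * W * (V * diagonal (fun i => √(l i)) * W)ᵀ
        = V * diagonal (fun i => √(l i)) * (W * Wᵀ) * diagonal (fun i => √(l i)) * Vᵀ := by
          simp only [transpose_mul, diagonal_transpose, Matrix.mul_assoc]
      _ = K := by
          rw [hW, Matrix.mul_one, Matrix.mul_assoc V, hsqrt, ← hKV]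
  · have hone (i : n) : ∑ j, W i j = if i = i₀ then √(Fintype.card n) else 0 := by
      have h := congrFun (congrFun hW i) i₀
      simp only [mul_apply, transpose_apply, hrow, ← Finset.sum_mul, one_apply] at h
      have hs : √(Fintype.card n : ℝ) ≠ 0 := (Real.sqrt_pos.2 hcard).ne'
      rw [mul_inv_eq_iff_eq_mul₀ hs] at h
      rw [h]
      split_ifs <;> simp
    have hentry : W * of (fun _ _ => (1 : ℝ)) * Wᵀ = single i₀ i₀ (Fintype.card n : ℝ) := by
      ext i j
      have : (W * of (fun _ _ => (1 : ℝ)) * Wᵀ : Matrix n n ℝ) i j = (∑ k, W i k) * ∑ k, W j k := by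
        simp [mul_apply, Finset.mul_sum]
      rw [this, hone, hone, single_apply]
      by_cases hi : i = i₀ <;> by_cases hj : j = i₀ <;> simp [hi, hj, eq_comm (a := i₀)]
    calc _ = (V * (diagonal (fun i => √(l i)) * (W * of (fun _ _ => (1 : ℝ)) * Wᵀ) *
          diagonal (fun i => √(l i)) * Vᵀ)).trace := by
          simp only [transpose_mul, diagonal_transpose, Matrix.mul_assoc]
      _ = (diagonal l * (W * of (fun _ _ => (1 : ℝ)) * Wᵀ)).trace := by
          rw [trace_mul_comm, Matrix.mul_assoc, hV', Matrix.mul_one, trace_mul_comm,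
            ← Matrix.mul_assoc, hsqrt]
      _ = _ := by
          rw [hentry]
          simp [trace, diagonal_mul, single_apply, mul_comm]

/-- Every eigenvalue of `K` is realized as the inverse of an attained spectral gap. -/
theorem exists_admissible_of_eigenvalue {d : ℕ} {K : Matrix (Fin d) (Fin d) ℝ} (hK : K.PosDef)
    (i₀ : Fin d) :
    ∃ D J : Matrix (Fin d) (Fin d) ℝ, D.PosSemidef ∧ D.trace = d ∧ Jᵀ = -J ∧
      ∀ z ∈ spectrum ℂ (((D + J) * K⁻¹).map Complex.ofReal),
        z.re = (hK.isHermitian.eigenvalues i₀)⁻¹ := by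
  obtain ⟨R, hR, htr⟩ := exists_factorization_sum_sq hK i₀
  have hm := hK.eigenvalues_pos i₀
  set m := hK.isHermitian.eigenvalues i₀
  let q : Fin d → ℝ := fun k => (k : ℝ) + 1
  have hq : Function.Injective q := fun j k h => by
    simpa [q, Fin.ext_iff] using h
  have hqpos (k : Fin d) : 0 < q k := by positivity
  have hdetK : IsUnit K.det := hK.det_pos.ne'.isUnit
  have hdetR : IsUnit R.det := by
    rw [← hR, det_mul] at hdetK
    exact isUnit_of_mul_isUnit_left hdetK
  have hdetRT : IsUnit Rᵀ.det := by rwa [det_transpose]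
  have hRKR : Rᵀ * K⁻¹ * R = 1 := by
    rw [← hR, Matrix.mul_inv_rev, ← Matrix.mul_assoc, Matrix.mul_nonsing_inv _ hdetRT,
      Matrix.one_mul, Matrix.nonsing_inv_mul _ hdetR]
  let S : Matrix (Fin d) (Fin d) ℝ := of fun _ _ => 1
  let A : Matrix (Fin d) (Fin d) ℝ := of fun j k => (q j + q k) / (q j - q k)
  have hS : S.PosSemidef := by
    have : S = vecMulVec (fun _ => 1) (star fun _ => 1) := by
      ext; simp [S, vecMulVec_apply]
    rw [this]
    exact posSemidef_vecMulVec_self_star _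
  have hA : Aᵀ = -A := by
    ext j k
    simp only [A, transpose_apply, Matrix.neg_apply, of_apply]
    rw [← neg_sub (q j) (q k), div_neg, add_comm]
  have hQ : (R * diagonal q * Rᵀ).PosDef := by
    have := (PosDef.diagonal hqpos).mul_mul_conjTranspose_same (B := R)
      (vecMul_injective_of_isUnit ((isUnit_iff_isUnit_det _).2 hdetR))
    simpa using this
  refine ⟨m⁻¹ • (R * S * Rᵀ), m⁻¹ • (R * A * Rᵀ), ?_, ?_, ?_, fun z hz => ?_⟩
  · have : (R * S * Rᵀ).PosSemidef := by simpa using hS.mul_mul_conjTranspose_same R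
    exact this.smul (inv_nonneg.2 hm.le)
  · rw [trace_smul, htr]
    simp [field]
  · simp only [transpose_smul, transpose_mul, transpose_transpose, hA]
    simp [Matrix.mul_assoc]
  · refine re_eq_of_mem_spectrum_of_lyapunov hQ ?_ hz
    have hCQ : (m⁻¹ • (R * S * Rᵀ) + m⁻¹ • (R * A * Rᵀ)) * K⁻¹ * (R * diagonal q * Rᵀ) =
        m⁻¹ • (R * ((S + A) * diagonal q) * Rᵀ) := by
      calc _ = m⁻¹ • (R * (S + A) * (Rᵀ * K⁻¹ * R) * diagonal q * Rᵀ) := by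
            simp only [← smul_add, ← Matrix.add_mul, ← Matrix.mul_add, Matrix.smul_mul,
              Matrix.mul_assoc]
        _ = _ := by simp only [hRKR, Matrix.mul_one, Matrix.mul_assoc]
    rw [hCQ]
    calc m⁻¹ • (R * ((S + A) * diagonal q) * Rᵀ) + (m⁻¹ • (R * ((S + A) * diagonal q) * Rᵀ))ᵀ
        = m⁻¹ • (R * ((S + A) * diagonal q + ((S + A) * diagonal q)ᵀ) * Rᵀ) := by
          rw [transpose_smul, ← smul_add, transpose_mul, transpose_mul, transpose_transpose,
            Matrix.mul_add R, Matrix.add_mul _ _ Rᵀ,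
            Matrix.mul_assoc R (_)ᵀ]
      _ = _ := by
          rw [cauchy_lyapunov hq, Matrix.mul_smul, Matrix.smul_mul, smul_smul, mul_comm]

theorem iInf_eigenvalues_inv_eq_iSup {n : Type*} [Fintype n] [DecidableEq n] [Nonempty n]
    {K : Matrix n n ℝ} (hK : K.PosDef) :
    (⨅ i, hK.isHermitian.eigenvalues i)⁻¹ = ⨆ i, hK.inv.isHermitian.eigenvalues i := by
  obtain ⟨i₀, hi₀⟩ := exists_eq_ciInf_of_finite (f := hK.isHermitian.eigenvalues)
  have hmin (i : n) : hK.isHermitian.eigenvalues i₀ ≤ hK.isHermitian.eigenvalues i :=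
    hi₀ ▸ ciInf_le (Set.finite_range _).bddBelow i
  have hpos := hK.eigenvalues_pos
  have hiff (r : ℝ) : r⁻¹ ∈ Set.range hK.inv.isHermitian.eigenvalues ↔
      r ∈ Set.range hK.isHermitian.eigenvalues := by
    rw [← hK.inv.isHermitian.spectrum_real_eq_range_eigenvalues,
      ← hK.isHermitian.spectrum_real_eq_range_eigenvalues]
    have h := spectrum.map_inv (𝕜 := ℝ) hK.isUnit.unit
    rw [Matrix.coe_units_inv, IsUnit.unit_spec] at h
    rw [← h, Set.inv_mem_inv]
  rw [← hi₀]
  apply le_antisymm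
  · obtain ⟨j, hj⟩ := (hiff _).2 ⟨i₀, rfl⟩
    rw [← hj]
    exact le_ciSup (Set.finite_range hK.inv.isHermitian.eigenvalues).bddAbove j
  · refine ciSup_le fun j => ?_
    obtain ⟨i, hi⟩ := (hiff (hK.inv.isHermitian.eigenvalues j)⁻¹).1 (by simp)
    rw [← inv_inv (hK.inv.isHermitian.eigenvalues j), ← hi]
    exact inv_anti₀ (hpos i₀) (hmin i)

/-- The maximum spectral gap `ρ(C) = min{Re λ : λ ∈ σ(C)}` over all admissible pairs
`(C, D) = ((D+J)K⁻¹, D)` with `D` symmetric positive semidefinite, `Tr D ≤ d` and `J`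
antisymmetric, equals `λ_max(K⁻¹) = 1/λ_min(K)`, and it is attained. -/
theorem max_spectral_gap {d : ℕ} (hd : 2 ≤ d)
    (K : Matrix (Fin d) (Fin d) ℝ) (hK : K.PosDef) :
    IsGreatest
      { r : ℝ | ∃ D J : Matrix (Fin d) (Fin d) ℝ, D.PosSemidef ∧ D.trace ≤ (d : ℝ) ∧
          Jᵀ = -J ∧
          r = sInf (Complex.re '' spectrum ℂ (((D + J) * K⁻¹).map (Complex.ofReal))) }
      ((⨅ i, hK.isHermitian.eigenvalues i)⁻¹) ∧
    (⨅ i, hK.isHermitian.eigenvalues i)⁻¹ = ⨆ i, hK.inv.isHermitian.eigenvalues i := by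
  have : NeZero d := ⟨by omega⟩
  refine ⟨⟨?_, ?_⟩, iInf_eigenvalues_inv_eq_iSup hK⟩
  · obtain ⟨i₀, hi₀⟩ := exists_eq_ciInf_of_finite (f := hK.isHermitian.eigenvalues)
    obtain ⟨D, J, hD, htr, hJ, hre⟩ := exists_admissible_of_eigenvalue hK i₀
    refine ⟨D, J, hD, htr.le, hJ, ?_⟩
    have hne := spectrum.nonempty_of_isAlgClosed_of_finiteDimensional ℂ
      (((D + J) * K⁻¹).map Complex.ofReal)
    have himage : Complex.re '' spectrum ℂ (((D + J) * K⁻¹).map Complex.ofReal) =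
        {(hK.isHermitian.eigenvalues i₀)⁻¹} :=
      Set.eq_singleton_iff_nonempty_unique_mem.2
        ⟨hne.image _, by rintro _ ⟨z, hz, rfl⟩; exact hre z hz⟩
    rw [himage, csInf_singleton, hi₀]
  · rintro r ⟨D, J, hD, htr, hJ, rfl⟩
    obtain ⟨i₀, hi₀⟩ := exists_eq_ciInf_of_finite (f := hK.isHermitian.eigenvalues)
    have hm : 0 < ⨅ i, hK.isHermitian.eigenvalues i := hi₀ ▸ hK.eigenvalues_pos i₀
    have hbound := card_mul_sInf_re_spectrum_le_re_trace (((D + J) * K⁻¹).map Complex.ofReal)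
    have htrace : (((D + J) * K⁻¹).map Complex.ofReal).trace.re = (D * K⁻¹).trace := by
      have hJK : (J * K⁻¹).trace = 0 :=
        trace_mul_eq_zero_of_transpose_eq_neg hJ (by simpa using hK.inv.isHermitian.eq)
      have hadd : ((D + J) * K⁻¹).trace = (D * K⁻¹).trace := by
        rw [Matrix.add_mul, trace_add, hJK, add_zero]
      rw [← hadd]
      simp [trace]
    have hDK := trace_mul_inv_le hK hD hm
      fun i => ciInf_le (Set.finite_range hK.isHermitian.eigenvalues).bddBelow i
    rw [htrace, Fintype.card_fin] at hbound
    have hd0 : (0 : ℝ) < d := by exact_mod_cast (by omega : 0 < d)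
    refine le_of_mul_le_mul_left ?_ hd0
    calc _ ≤ _ := hbound
      _ ≤ _ := hDK
      _ ≤ (⨅ i, hK.isHermitian.eigenvalues i)⁻¹ * d :=
        mul_le_mul_of_nonneg_left htr (inv_nonneg.2 hm.le)
      _ = _ := mul_comm _ _
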